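/- Let φ(x) = (2π)^{−1/2} e^{−x²/2} be the standard normal density and Φ its cumulative distribution function. Then for every x ∈ ℝ, φ(x)² / {Φ(x)(1−Φ(x))} ≤ 2/π, with equality if and only if x = 0. Equivalently, the function ξ ↦ φ(Φ^{−1}(ξ))² / {ξ(1−ξ)} on (0,1) attains its maximum, equal to 2/π, uniquely at ξ = 1/2. -/

import Mathlib

open Real MeasureTheory

noncomputable section

/-- The standard normal density `φ(x) = (2π)^{−1/2} e^{−x²/2}`. -/
def stdNormPDF (x : ℝ) : ℝ := (Real.sqrt (2 * Real.pi))⁻¹ * Real.exp (-x ^ 2 / 2)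

/-- The standard normal cumulative distribution function `Φ`. -/
def stdNormCDF (x : ℝ) : ℝ := ∫ t in Set.Iic x, stdNormPDF t

open Filter Topology

/-- The unnormalised Gaussian primitive `∫₀ˣ e^{−t²/2} dt`. -/
def gaussPrimitive (x : ℝ) : ℝ := ∫ t in (0 : ℝ)..x, Real.exp (-t ^ 2 / 2)

lemma continuous_exp_neg_sq_div_two : Continuous fun t : ℝ => Real.exp (-t ^ 2 / 2) := by
  fun_prop

lemma hasDerivAt_exp_neg_sq_div_two (x : ℝ) :
    HasDerivAt (fun t : ℝ => Real.exp (-t ^ 2 / 2)) (-x * Real.exp (-x ^ 2 / 2)) x := by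
  have h : HasDerivAt (fun t : ℝ => -t ^ 2 / 2) (-x) x := by
    refine ((hasDerivAt_pow 2 x).neg.div_const 2).congr_deriv ?_
    norm_num
    ring
  exact h.exp.congr_deriv (mul_comm _ _)

lemma integrable_exp_neg_sq_div_two : Integrable fun t : ℝ => Real.exp (-t ^ 2 / 2) := by
  convert integrable_exp_neg_mul_sq (b := 1 / 2) (by norm_num) using 3
  ring

lemma integral_Ioi_exp_neg_sq_div_two :
    ∫ t in Set.Ioi (0 : ℝ), Real.exp (-t ^ 2 / 2) = Real.sqrt (2 * Real.pi) / 2 := by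
  convert integral_gaussian_Ioi (1 / 2) using 3
  · ring_nf
  · ring_nf

lemma integral_Iic_exp_neg_sq_div_two :
    ∫ t in Set.Iic (0 : ℝ), Real.exp (-t ^ 2 / 2) = Real.sqrt (2 * Real.pi) / 2 := by
  rw [← integral_Ioi_exp_neg_sq_div_two]
  have h := integral_comp_neg_Iic (0 : ℝ) fun t : ℝ => Real.exp (-t ^ 2 / 2)
  simpa only [neg_sq, neg_zero] using h

@[simp]
lemma gaussPrimitive_zero : gaussPrimitive 0 = 0 := by
  simp [gaussPrimitive]

lemma gaussPrimitive_neg (x : ℝ) : gaussPrimitive (-x) = -gaussPrimitive x := by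
  have h := intervalIntegral.integral_comp_neg (a := 0) (b := x)
    fun t : ℝ => Real.exp (-t ^ 2 / 2)
  rw [gaussPrimitive, gaussPrimitive, intervalIntegral.integral_symm]
  simpa using h.symm

lemma hasDerivAt_gaussPrimitive (x : ℝ) :
    HasDerivAt gaussPrimitive (Real.exp (-x ^ 2 / 2)) x :=
  intervalIntegral.integral_hasDerivAt_right
    (continuous_exp_neg_sq_div_two.intervalIntegrable _ _)
    (continuous_exp_neg_sq_div_two.stronglyMeasurableAtFilter _ _)
    continuous_exp_neg_sq_div_two.continuousAt

lemma strictMono_gaussPrimitive : StrictMono gaussPrimitive :=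
  strictMono_of_deriv_pos fun x => by
    rw [(hasDerivAt_gaussPrimitive x).deriv]
    positivity

lemma tendsto_gaussPrimitive_atTop :
    Tendsto gaussPrimitive atTop (𝓝 (Real.sqrt (2 * Real.pi) / 2)) := by
  rw [← integral_Ioi_exp_neg_sq_div_two]
  exact intervalIntegral_tendsto_integral_Ioi 0
    integrable_exp_neg_sq_div_two.integrableOn tendsto_id

lemma stdNormCDF_eq (x : ℝ) :
    stdNormCDF x = 1 / 2 + gaussPrimitive x / Real.sqrt (2 * Real.pi) := by
  have h := intervalIntegral.integral_Iic_sub_Iic (a := 0) (b := x)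
    integrable_exp_neg_sq_div_two.integrableOn integrable_exp_neg_sq_div_two.integrableOn
  rw [integral_Iic_exp_neg_sq_div_two, sub_eq_iff_eq_add] at h
  have hs : Real.sqrt (2 * Real.pi) ≠ 0 := by positivity
  simp only [stdNormCDF, stdNormPDF]
  rw [integral_const_mul, h, gaussPrimitive]
  field_simp
  ring

lemma stdNormPDF_sq (x : ℝ) : stdNormPDF x ^ 2 = Real.exp (-x ^ 2) / (2 * Real.pi) := by
  rw [stdNormPDF, mul_pow, inv_pow, Real.sq_sqrt (by positivity), ← Real.exp_nat_mul]
  push_cast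
  ring_nf

lemma stdNormCDF_mul_one_sub (x : ℝ) :
    stdNormCDF x * (1 - stdNormCDF x) = 1 / 4 - gaussPrimitive x ^ 2 / (2 * Real.pi) := by
  have hs : Real.sqrt (2 * Real.pi) ^ 2 = 2 * Real.pi := Real.sq_sqrt (by positivity)
  rw [stdNormCDF_eq]
  nth_rewrite 3 [← hs]
  ring

lemma hasDerivAt_gap (x : ℝ) :
    HasDerivAt (fun x => Real.pi / 2 * (1 - Real.exp (-x ^ 2 / 2) ^ 2) - gaussPrimitive x ^ 2)
      (Real.exp (-x ^ 2 / 2) * (Real.pi * x * Real.exp (-x ^ 2 / 2) - 2 * gaussPrimitive x))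
      x := by
  refine (((((hasDerivAt_exp_neg_sq_div_two x).pow 2).const_sub 1).const_mul
    (Real.pi / 2)).sub ((hasDerivAt_gaussPrimitive x).pow 2)).congr_deriv ?_
  push_cast
  ring

lemma hasDerivAt_gapFactor (x : ℝ) :
    HasDerivAt (fun x => Real.pi * x * Real.exp (-x ^ 2 / 2) - 2 * gaussPrimitive x)
      (Real.exp (-x ^ 2 / 2) * (Real.pi - 2 - Real.pi * x ^ 2)) x := by
  refine ((((hasDerivAt_id x).const_mul Real.pi).mul (hasDerivAt_exp_neg_sq_div_two x)).sub
    ((hasDerivAt_gaussPrimitive x).const_mul 2)).congr_deriv ?_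
  simp only [id]
  ring

lemma gaussPrimitive_sq_lt_of_pos {x : ℝ} (hx : 0 < x) :
    gaussPrimitive x ^ 2 < Real.pi / 2 * (1 - Real.exp (-x ^ 2 / 2) ^ 2) := by
  set K : ℝ → ℝ :=
    fun x => Real.pi / 2 * (1 - Real.exp (-x ^ 2 / 2) ^ 2) - gaussPrimitive x ^ 2 with hK
  set h : ℝ → ℝ :=
    fun x => Real.pi * x * Real.exp (-x ^ 2 / 2) - 2 * gaussPrimitive x with hh
  have hKd : ∀ y, HasDerivAt K (Real.exp (-y ^ 2 / 2) * h y) y := hasDerivAt_gap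
  have hhd : ∀ y, HasDerivAt h (Real.exp (-y ^ 2 / 2) * (Real.pi - 2 - Real.pi * y ^ 2)) y :=
    hasDerivAt_gapFactor
  have hKc : Continuous K := continuous_iff_continuousAt.2 fun y => (hKd y).continuousAt
  have hhc : Continuous h := continuous_iff_continuousAt.2 fun y => (hhd y).continuousAt
  have hK0 : K 0 = 0 := by simp [hK]
  have hh0 : h 0 = 0 := by simp [hh]
  have hpi := Real.pi_gt_three
  suffices 0 < K x by simpa [hK] using this
  set c : ℝ := Real.sqrt ((Real.pi - 2) / Real.pi) with hc
  have hcsq : Real.pi * c ^ 2 = Real.pi - 2 := by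
    rw [hc, Real.sq_sqrt (div_nonneg (by linarith) (by linarith))]
    field_simp
  have hc0 : 0 ≤ c := Real.sqrt_nonneg _
  have hmono : StrictMonoOn h (Set.Icc 0 c) := by
    refine strictMonoOn_of_deriv_pos (convex_Icc 0 c) hhc.continuousOn fun y hy => ?_
    rw [interior_Icc] at hy
    rw [(hhd y).deriv]
    have : y ^ 2 < c ^ 2 := pow_lt_pow_left₀ hy.2 hy.1.le two_ne_zero
    exact mul_pos (Real.exp_pos _) (by nlinarith)
  have hanti : StrictAntiOn h (Set.Ici c) := by
    refine strictAntiOn_of_deriv_neg (convex_Ici c) hhc.continuousOn fun y hy => ?_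
    rw [interior_Ici] at hy
    rw [(hhd y).deriv]
    have : c ^ 2 < y ^ 2 := pow_lt_pow_left₀ hy hc0 two_ne_zero
    exact mul_neg_of_pos_of_neg (Real.exp_pos _) (by nlinarith)
  have hinit : ∀ y, 0 < y → y ≤ c → 0 < h y := fun y hy hyc =>
    hh0 ▸ hmono ⟨le_rfl, hc0⟩ ⟨hy.le, hyc⟩ hy
  rcases le_or_gt 0 (h x) with hx0 | hx0
  · have hKmono : StrictMonoOn K (Set.Icc 0 x) := by
      refine strictMonoOn_of_deriv_pos (convex_Icc 0 x) hKc.continuousOn fun y hy => ?_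
      rw [interior_Icc] at hy
      rw [(hKd y).deriv]
      refine mul_pos (Real.exp_pos _) ?_
      rcases le_or_gt y c with hyc | hyc
      · exact hinit y hy.1 hyc
      · exact hx0.trans_lt (hanti hyc.le (hyc.trans hy.2).le hy.2)
    exact hK0 ▸ hKmono ⟨le_rfl, hx.le⟩ ⟨hx.le, le_rfl⟩ hx
  · have hcx : c < x := by
      by_contra! hle
      exact (hinit x hx hle).not_gt hx0
    have hKanti : StrictAntiOn K (Set.Ici x) := by
      refine strictAntiOn_of_deriv_neg (convex_Ici x) hKc.continuousOn fun y hy => ?_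
      rw [interior_Ici] at hy
      rw [(hKd y).deriv]
      exact mul_neg_of_pos_of_neg (Real.exp_pos _)
        ((hanti hcx.le (hcx.trans hy).le hy).trans hx0)
    have hexp : Tendsto (fun y : ℝ => Real.exp (-y ^ 2 / 2)) atTop (𝓝 0) := by
      refine Real.tendsto_exp_atBot.comp ?_
      simp_rw [neg_div]
      exact tendsto_neg_atTop_atBot.comp
        ((tendsto_pow_atTop two_ne_zero).atTop_div_const two_pos)
    have hlim : Tendsto K atTop (𝓝 0) := by
      have := (((hexp.pow 2).const_sub 1).const_mul (Real.pi / 2)).sub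
        (tendsto_gaussPrimitive_atTop.pow 2)
      rwa [div_pow, Real.sq_sqrt (by positivity),
        show Real.pi / 2 * (1 - 0 ^ 2) - 2 * Real.pi / 2 ^ 2 = 0 by ring] at this
    have hnonneg : 0 ≤ K (x + 1) := by
      refine le_of_tendsto hlim ?_
      filter_upwards [eventually_ge_atTop (x + 1)] with y hy
      exact hKanti.antitoneOn (by simp) (Set.mem_Ici.2 (by linarith)) hy
    exact hnonneg.trans_lt (hKanti (by simp) (by simp) (by linarith))

lemma gaussPrimitive_sq_lt {x : ℝ} (hx : x ≠ 0) :
    gaussPrimitive x ^ 2 < Real.pi / 2 * (1 - Real.exp (-x ^ 2)) := by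
  have hexp : Real.exp (-x ^ 2) = Real.exp (-x ^ 2 / 2) ^ 2 := by
    rw [← Real.exp_nat_mul]
    push_cast
    ring_nf
  rw [hexp]
  rcases hx.lt_or_gt with hx | hx
  · simpa [gaussPrimitive_neg] using gaussPrimitive_sq_lt_of_pos (neg_pos.2 hx)
  · exact gaussPrimitive_sq_lt_of_pos hx

lemma stdNormCDF_zero : stdNormCDF 0 = 1 / 2 := by
  simp [stdNormCDF_eq]

lemma stdNormCDF_eq_half_iff {x : ℝ} : stdNormCDF x = 1 / 2 ↔ x = 0 := by
  have hs : Real.sqrt (2 * Real.pi) ≠ 0 := by positivity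
  rw [stdNormCDF_eq, add_eq_left, div_eq_zero_iff, or_iff_left hs,
    ← strictMono_gaussPrimitive.injective.eq_iff (a := x), gaussPrimitive_zero]

lemma stdNormPDF_ratio_zero :
    stdNormPDF 0 ^ 2 / (stdNormCDF 0 * (1 - stdNormCDF 0)) = 2 / Real.pi := by
  rw [stdNormPDF_sq, stdNormCDF_zero]
  norm_num
  field_simp
  norm_num

lemma stdNormPDF_ratio_lt {x : ℝ} (hx : x ≠ 0) :
    stdNormPDF x ^ 2 / (stdNormCDF x * (1 - stdNormCDF x)) < 2 / Real.pi := by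
  have hlt := gaussPrimitive_sq_lt hx
  have hgap : Real.exp (-x ^ 2) / 4 < 1 / 4 - gaussPrimitive x ^ 2 / (2 * Real.pi) := by
    rw [lt_sub_iff_add_lt, ← lt_sub_iff_add_lt', div_lt_iff₀ (by positivity)]
    linarith
  rw [stdNormPDF_sq, stdNormCDF_mul_one_sub, div_lt_iff₀ (lt_trans (by positivity) hgap)]
  calc Real.exp (-x ^ 2) / (2 * Real.pi) = 2 / Real.pi * (Real.exp (-x ^ 2) / 4) := by
        field_simp
        norm_num
    _ < _ := mul_lt_mul_of_pos_left hgap (by positivity)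

/-- `φ(x)²/{Φ(x)(1−Φ(x))} ≤ 2/π` for all `x`, with equality iff `x = 0`;
equivalently, `ξ ↦ φ(Φ⁻¹(ξ))²/{ξ(1−ξ)}` on `(0,1)` attains its maximum `2/π` uniquely
at `ξ = 1/2`. -/
theorem gaussian_ratio_max :
    (∀ x : ℝ,
      stdNormPDF x ^ 2 / (stdNormCDF x * (1 - stdNormCDF x)) ≤ 2 / Real.pi ∧
      (stdNormPDF x ^ 2 / (stdNormCDF x * (1 - stdNormCDF x)) = 2 / Real.pi ↔ x = 0)) ∧
    (∀ ξ ∈ Set.Ioo (0 : ℝ) 1, ∀ x : ℝ, stdNormCDF x = ξ →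
      stdNormPDF x ^ 2 / (ξ * (1 - ξ)) ≤ 2 / Real.pi ∧
      (stdNormPDF x ^ 2 / (ξ * (1 - ξ)) = 2 / Real.pi ↔ ξ = 1 / 2)) := by
  have main : ∀ x : ℝ,
      stdNormPDF x ^ 2 / (stdNormCDF x * (1 - stdNormCDF x)) ≤ 2 / Real.pi ∧
      (stdNormPDF x ^ 2 / (stdNormCDF x * (1 - stdNormCDF x)) = 2 / Real.pi ↔ x = 0) := by
    intro x
    rcases eq_or_ne x 0 with rfl | hx
    · simp only [stdNormPDF_ratio_zero, le_refl, and_self]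
    · have hlt := stdNormPDF_ratio_lt hx
      exact ⟨hlt.le, iff_of_false hlt.ne hx⟩
  refine ⟨main, ?_⟩
  rintro _ - x rfl
  rw [stdNormCDF_eq_half_iff]
  exact main x

end
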